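/- There is a constant C₁ < ∞ such that for every integer m ≥ 2, every k ∈ 𝕋∖{0}, every N ≥ 1 and every τ > 0: ∫₀^∞ e^{−z} ∫_𝕋 p^m(k,k')·1{|ψ(k')| > N^{2/3}τ z^{−1}} dk' dz ≤ C₁·[cos²(πk)/(1+2cos²(πk)) + sin²(πk)/(1+2cos²(πk))]·N^{−1}·τ^{−3/2}. -/

import Mathlib

noncomputable section

open MeasureTheory ProbabilityTheory Real Filter Set Topology

/-- The one-dimensional torus `𝕋 = ℝ/ℤ`, identified with `[-1/2, 1/2)`. -/
def Tor : Set ℝ := Set.Ico (-(1/2) : ℝ) (1/2)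

/-- The velocity `v(k) = sin(2πk)/|sin(πk)|` (equal to `0` at `k = 0`). -/
def vv (k : ℝ) : ℝ := Real.sin (2 * π * k) / |Real.sin (π * k)|

/-- The scattering kernel `R(k,k')`. -/
def RR (k k' : ℝ) : ℝ :=
  (4 / 3) * (2 * Real.sin (2 * π * k) ^ 2 * Real.sin (π * k') ^ 2
    + 2 * Real.sin (2 * π * k') ^ 2 * Real.sin (π * k) ^ 2
    - Real.sin (2 * π * k) ^ 2 * Real.sin (2 * π * k') ^ 2)

/-- `φ(k) = ∫_𝕋 R(k,k') dk' = (4/3) sin²(πk)(1+2cos²(πk))`. -/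
def phi (k : ℝ) : ℝ := (4 / 3) * Real.sin (π * k) ^ 2 * (1 + 2 * Real.cos (π * k) ^ 2)

/-- The transition probability density `p(k,k') = R(k,k')/φ(k)` (for `k ≠ 0`). -/
def pp (k k' : ℝ) : ℝ := RR k k' / phi k

/-- `ψ(k) = v(k)/φ(k)` (equal to `0` at `k = 0`). -/
def psi (k : ℝ) : ℝ := vv k / phi k

/-- The `m`-step transition densities: `p¹ = p`,
`p^{m+1}(k,k') = ∫_𝕋 p^m(k,k₁) p(k₁,k') dk₁` (`p⁰` is set to `0`; it is never used). -/
def pm : ℕ → ℝ → ℝ → ℝ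
  | 0, _, _ => 0
  | 1, k, k' => pp k k'
  | (m + 2), k, k' => ∫ k₁ in Tor, pm (m + 1) k k₁ * pp k₁ k'

theorem rr_eq (k k' : ℝ) :
    RR k k' = 32 / 3 * sin (π * k) ^ 2 * cos (π * k) ^ 2 * (sin (π * k') ^ 4)
      + 32 / 3 * sin (π * k) ^ 4 * (sin (π * k') ^ 2 * cos (π * k') ^ 2) := by
  have h : ∀ x : ℝ, sin (2 * π * x) = 2 * sin (π * x) * cos (π * x) := fun x => by
    rw [mul_assoc, sin_two_mul]
  have hc := cos_sq' (π * k)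
  have hc' := cos_sq' (π * k')
  simp only [RR, h, mul_pow]
  rw [hc, hc']
  ring

/-- Coefficient of `sin⁴(πk')` in `p(k,k')`. -/
def sinCoeff (k : ℝ) : ℝ := 32 / 3 * sin (π * k) ^ 2 * cos (π * k) ^ 2 / phi k

/-- Coefficient of `sin²(πk') cos²(πk')` in `p(k,k')`. -/
def cosCoeff (k : ℝ) : ℝ := 32 / 3 * sin (π * k) ^ 4 / phi k

theorem pp_eq (k k' : ℝ) :
    pp k k' = sinCoeff k * sin (π * k') ^ 4
      + cosCoeff k * (sin (π * k') ^ 2 * cos (π * k') ^ 2) := by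
  rw [pp, rr_eq, sinCoeff, cosCoeff]
  ring

theorem phi_nonneg (k : ℝ) : 0 ≤ phi k := by
  unfold phi
  positivity

theorem sinCoeff_nonneg (k : ℝ) : 0 ≤ sinCoeff k :=
  div_nonneg (by positivity) (phi_nonneg k)

theorem cosCoeff_nonneg (k : ℝ) : 0 ≤ cosCoeff k :=
  div_nonneg (by positivity) (phi_nonneg k)

theorem coeff_mass_le_one (k : ℝ) : 3 / 8 * sinCoeff k + 1 / 8 * cosCoeff k ≤ 1 := by
  have h : 3 / 8 * sinCoeff k + 1 / 8 * cosCoeff k = phi k / phi k := by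
    have hs := sin_sq (π * k)
    rw [sinCoeff, cosCoeff, mul_div_assoc', mul_div_assoc', ← add_div]
    congr 1
    rw [phi, show sin (π * k) ^ 4 = sin (π * k) ^ 2 * sin (π * k) ^ 2 by ring, hs]
    ring
  rw [h]
  exact div_self_le_one _

theorem continuous_phi : Continuous phi := by
  unfold phi
  fun_prop

theorem measurable_sinCoeff : Measurable sinCoeff := by
  have := continuous_phi.measurable
  unfold sinCoeff
  fun_prop

theorem measurable_cosCoeff : Measurable cosCoeff := by
  have := continuous_phi.measurable
  unfold cosCoeff
  fun_prop

theorem setIntegral_tor_comp_pi_mul (f : ℝ → ℝ) :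
    ∫ k in Tor, f (π * k) = π⁻¹ * ∫ x in (-(π / 2))..(π / 2), f x := by
  rw [Tor, integral_Ico_eq_integral_Ioc, ← intervalIntegral.integral_of_le (by norm_num),
    intervalIntegral.integral_comp_mul_left _ pi_ne_zero, smul_eq_mul]
  congr 2 <;> ring

theorem setIntegral_tor_sin_pow_four : ∫ k in Tor, sin (π * k) ^ 4 = 3 / 8 := by
  rw [setIntegral_tor_comp_pi_mul (fun x => sin x ^ 4), integral_sin_pow (n := 2), integral_sin_sq]
  simp
  field_simp
  norm_num

theorem setIntegral_tor_sin_sq_mul_cos_sq :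
    ∫ k in Tor, sin (π * k) ^ 2 * cos (π * k) ^ 2 = 1 / 8 := by
  rw [setIntegral_tor_comp_pi_mul (fun x => sin x ^ 2 * cos x ^ 2), integral_sin_sq_mul_cos_sq,
    show 4 * (π / 2) = 2 * π by ring, show 4 * (-(π / 2)) = -(2 * π) by ring]
  simp
  field_simp

theorem integrableOn_tor_of_continuous {f : ℝ → ℝ} (hf : Continuous f) : IntegrableOn f Tor :=
  (hf.integrableOn_Icc (a := -(1 / 2)) (b := 1 / 2)).mono_set Ico_subset_Icc_self

/-- The space spanned by `sin⁴(πk')` and `sin²(πk') cos²(πk')`, with nonnegative coefficients and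
total mass at most one, contains all the densities `p^m(k, ·)` with `m ≥ 1`. -/
theorem exists_pm_succ_eq (m : ℕ) (k : ℝ) :
    ∃ A B : ℝ, 0 ≤ A ∧ 0 ≤ B ∧ 3 / 8 * A + 1 / 8 * B ≤ 1 ∧
      ∀ k', pm (m + 1) k k' = A * sin (π * k') ^ 4
        + B * (sin (π * k') ^ 2 * cos (π * k') ^ 2) := by
  induction m with
  | zero =>
    exact ⟨sinCoeff k, cosCoeff k, sinCoeff_nonneg k, cosCoeff_nonneg k, coeff_mass_le_one k,
      fun k' => by rw [← pp_eq]; rfl⟩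
  | succ m ih =>
    obtain ⟨A, B, hA, hB, hAB, h⟩ := ih
    have hcont : Continuous (pm (m + 1) k) := by
      rw [funext h]
      fun_prop
    have hnonneg : ∀ x, 0 ≤ pm (m + 1) k x := fun x => by
      rw [h]
      positivity
    have hint : IntegrableOn (pm (m + 1) k) Tor := integrableOn_tor_of_continuous hcont
    have hmass : ∫ x in Tor, pm (m + 1) k x ≤ 1 := by
      rw [funext h, integral_add, integral_const_mul, integral_const_mul,
        setIntegral_tor_sin_pow_four, setIntegral_tor_sin_sq_mul_cos_sq]
      · linarith
      · exact integrableOn_tor_of_continuous (by fun_prop)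
      · exact integrableOn_tor_of_continuous (by fun_prop)
    have hintS : IntegrableOn (fun x => pm (m + 1) k x * sinCoeff x) Tor := by
      refine Integrable.mul_bdd (c := 8) hint measurable_sinCoeff.aestronglyMeasurable
        (Eventually.of_forall fun x => ?_)
      rw [norm_of_nonneg (sinCoeff_nonneg x)]
      linarith [coeff_mass_le_one x, cosCoeff_nonneg x, sinCoeff_nonneg x]
    have hintC : IntegrableOn (fun x => pm (m + 1) k x * cosCoeff x) Tor := by
      refine Integrable.mul_bdd (c := 8) hint measurable_cosCoeff.aestronglyMeasurable
        (Eventually.of_forall fun x => ?_)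
      rw [norm_of_nonneg (cosCoeff_nonneg x)]
      linarith [coeff_mass_le_one x, cosCoeff_nonneg x, sinCoeff_nonneg x]
    refine ⟨∫ x in Tor, pm (m + 1) k x * sinCoeff x, ∫ x in Tor, pm (m + 1) k x * cosCoeff x,
      integral_nonneg fun x => mul_nonneg (hnonneg x) (sinCoeff_nonneg x),
      integral_nonneg fun x => mul_nonneg (hnonneg x) (cosCoeff_nonneg x), ?_, fun k' => ?_⟩
    · rw [← integral_const_mul, ← integral_const_mul,
        ← integral_add (hintS.const_mul _) (hintC.const_mul _)]
      refine (integral_mono ((hintS.const_mul _).add (hintC.const_mul _)) hint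
        fun x => ?_).trans hmass
      have := mul_le_mul_of_nonneg_left (coeff_mass_le_one x) (hnonneg x)
      simp only [Pi.add_apply]
      linarith
    · rw [← integral_mul_const, ← integral_mul_const,
        ← integral_add (hintS.mul_const _) (hintC.mul_const _)]
      change ∫ x in Tor, pm (m + 1) k x * pp x k' = _
      refine integral_congr_ae (Eventually.of_forall fun x => ?_)
      simp only [pp_eq]
      ring

theorem pm_succ_nonneg (m : ℕ) (k k' : ℝ) : 0 ≤ pm (m + 1) k k' := by
  obtain ⟨A, B, hA, hB, -, h⟩ := exists_pm_succ_eq m k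
  rw [h]
  positivity

theorem pm_succ_le (m : ℕ) (k k' : ℝ) : pm (m + 1) k k' ≤ 8 * sin (π * k') ^ 2 := by
  obtain ⟨A, B, hA, hB, hAB, h⟩ := exists_pm_succ_eq m k
  have hA8 : A ≤ 8 := by linarith
  have hB8 : B ≤ 8 := by linarith
  calc pm (m + 1) k k'
      = A * sin (π * k') ^ 4 + B * (sin (π * k') ^ 2 * cos (π * k') ^ 2) := h k'
    _ ≤ 8 * sin (π * k') ^ 4 + 8 * (sin (π * k') ^ 2 * cos (π * k') ^ 2) := by gcongr
    _ = 8 * sin (π * k') ^ 2 := by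
      rw [cos_sq']
      ring

theorem sin_sq_lt_of_lt_abs_psi {k l : ℝ} (hl : 0 < l) (h : l < |psi k|) :
    sin (π * k) ^ 2 < 3 / 2 / l := by
  rcases eq_or_ne (sin (π * k)) 0 with hs | hs
  · rw [hs, zero_pow two_ne_zero]
    positivity
  have hs2 : 0 < sin (π * k) ^ 2 := by positivity
  have hv : |vv k| ≤ 2 := by
    rw [vv, mul_assoc, sin_two_mul, abs_div, abs_abs, abs_mul, abs_mul, abs_two,
      div_le_iff₀ (abs_pos.2 hs)]
    nlinarith [abs_cos_le_one (π * k), abs_nonneg (sin (π * k))]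
  have hphi : 4 / 3 * sin (π * k) ^ 2 ≤ phi k := by
    unfold phi
    nlinarith [mul_nonneg hs2.le (sq_nonneg (cos (π * k)))]
  have hphi0 : 0 < phi k := by linarith
  rw [psi, abs_div, abs_of_pos hphi0, lt_div_iff₀ hphi0] at h
  rw [lt_div_iff₀ hl]
  nlinarith [mul_le_mul_of_nonneg_left hphi hl.le]

theorem setIntegral_pm_tail_le (m : ℕ) (k : ℝ) {l : ℝ} (hl : 0 < l) :
    (∫ k' in Tor, if l < |psi k'| then pm (m + 1) k k' else 0)
      ≤ 8 * (3 / 2 / l) ^ ((3 : ℝ) / 2) := by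
  set a := 3 / 2 / l
  have ha0 : 0 < a := by positivity
  set I : Set ℝ := Icc (-(√a / 2)) (√a / 2)
  have hint : Integrable (I.indicator fun _ => 8 * a) :=
    (integrable_indicator_iff measurableSet_Icc).2 continuous_const.integrableOn_Icc
  have hbound : ∀ k' ∈ Tor, (if l < |psi k'| then pm (m + 1) k k' else 0)
      ≤ I.indicator (fun _ => 8 * a) k' := by
    intro k' hk'
    split_ifs with h
    · have hs := sin_sq_lt_of_lt_abs_psi hl h
      have hmem : k' ∈ I := by
        have hk : |π * k'| ≤ π / 2 := by
          rw [abs_mul, abs_of_pos pi_pos]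
          have : |k'| ≤ 1 / 2 := abs_le.2 ⟨hk'.1, hk'.2.le⟩
          nlinarith [pi_pos]
        have h1 := mul_abs_le_abs_sin hk
        rw [abs_mul, abs_of_pos pi_pos, ← mul_assoc, div_mul_cancel₀ _ pi_ne_zero] at h1
        have h2 : |sin (π * k')| ≤ √a := abs_le_sqrt hs.le
        exact abs_le.1 (by linarith)
      rw [indicator_of_mem hmem]
      linarith [pm_succ_le m k k']
    · exact indicator_nonneg (fun _ _ => by positivity) _
  calc _ ≤ ∫ k' in Tor, I.indicator (fun _ => 8 * a) k' := by
        refine integral_mono_of_nonneg (Eventually.of_forall fun x => ?_) hint.integrableOn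
          ((ae_restrict_iff' measurableSet_Ico).2 (Eventually.of_forall hbound))
        dsimp only
        split_ifs
        exacts [pm_succ_nonneg m k x, le_rfl]
    _ ≤ ∫ k', I.indicator (fun _ => 8 * a) k' :=
        setIntegral_le_integral hint
          (Eventually.of_forall fun x => indicator_nonneg (fun _ _ => by positivity) x)
    _ = 8 * a ^ ((3 : ℝ) / 2) := by
        rw [integral_indicator measurableSet_Icc, setIntegral_const, Real.volume_real_Icc_of_le
          (by linarith [sqrt_nonneg a]), smul_eq_mul, show (3 : ℝ) / 2 = 1 + 1 / 2 by norm_num,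
          rpow_add ha0, rpow_one, ← sqrt_eq_rpow]
        ring

theorem three_halves_div_rpow {N τ z : ℝ} (hN : 0 < N) (hτ : 0 < τ) (hz : 0 < z) :
    (3 / 2 / (N ^ ((2 : ℝ) / 3) * τ * z⁻¹)) ^ ((3 : ℝ) / 2)
      = (3 / 2) ^ ((3 : ℝ) / 2) * N⁻¹ * τ ^ (-(3 : ℝ) / 2) * z ^ ((3 : ℝ) / 2) := by
  rw [div_rpow (by norm_num) (by positivity), mul_rpow (by positivity) (by positivity),
    mul_rpow (by positivity) hτ.le, ← rpow_mul hN.le, inv_rpow hz.le, neg_div, rpow_neg hτ.le]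
  norm_num
  field_simp

/-- Uniform estimate for `m ≥ 2`:
`∫₀^∞ e^{−z} ∫_𝕋 p^m(k,k') 1{|ψ(k')| > N^{2/3} τ z⁻¹} dk' dz
  ≤ C₁ [cos²(πk)/(1+2cos²(πk)) + sin²(πk)/(1+2cos²(πk))] N⁻¹ τ^{−3/2}`. -/
theorem tail_estimate_m_ge_two :
    ∃ C₁ : ℝ, ∀ m : ℕ, 2 ≤ m → ∀ k ∈ Tor, k ≠ 0 → ∀ N : ℝ, 1 ≤ N → ∀ τ : ℝ, 0 < τ →
      (∫ z in Set.Ioi (0 : ℝ), Real.exp (-z) *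
          ∫ k' in Tor, if N ^ ((2 : ℝ) / 3) * τ * z⁻¹ < |psi k'| then pm m k k' else 0)
        ≤ C₁ * (Real.cos (π * k) ^ 2 / (1 + 2 * Real.cos (π * k) ^ 2)
              + Real.sin (π * k) ^ 2 / (1 + 2 * Real.cos (π * k) ^ 2))
            * N⁻¹ * τ ^ (-(3 : ℝ) / 2) := by
  set D : ℝ := 8 * (3 / 2) ^ ((3 : ℝ) / 2) with hD
  have hG := Real.GammaIntegral_convergent (s := 5 / 2) (by norm_num)
  have hΓ : 0 < Gamma (5 / 2) := Gamma_pos_of_pos (by norm_num)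
  refine ⟨3 * D * Gamma (5 / 2), fun m hm k _ _ N hN τ hτ => ?_⟩
  obtain ⟨m, rfl⟩ : ∃ n, m = n + 1 := ⟨m - 1, by omega⟩
  have hN0 : 0 < N := by linarith
  have hfactor : 1 / 3 ≤ cos (π * k) ^ 2 / (1 + 2 * cos (π * k) ^ 2)
      + sin (π * k) ^ 2 / (1 + 2 * cos (π * k) ^ 2) := by
    rw [← add_div, cos_sq_add_sin_sq]
    exact one_div_le_one_div_of_le (by positivity) (by linarith [cos_sq_le_one (π * k)])
  calc _ ≤ ∫ z in Ioi (0 : ℝ),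
        D * N⁻¹ * τ ^ (-(3 : ℝ) / 2) * (exp (-z) * z ^ ((5 : ℝ) / 2 - 1)) := by
        refine integral_mono_of_nonneg (Eventually.of_forall fun z => ?_) (hG.const_mul _)
          ((ae_restrict_iff' measurableSet_Ioi).2 (Eventually.of_forall fun z hz => ?_))
        · refine mul_nonneg (exp_nonneg _) (integral_nonneg fun x => ?_)
          dsimp only
          split_ifs
          exacts [pm_succ_nonneg m k x, le_rfl]
        · have hz : 0 < z := hz
          have h := setIntegral_pm_tail_le m k
            (l := N ^ ((2 : ℝ) / 3) * τ * z⁻¹) (by positivity)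
          rw [three_halves_div_rpow hN0 hτ hz] at h
          refine (mul_le_mul_of_nonneg_left h (exp_nonneg _)).trans_eq ?_
          rw [show (5 : ℝ) / 2 - 1 = 3 / 2 by norm_num, hD]
          ring
    _ = 3 * D * Gamma (5 / 2) * (1 / 3) * N⁻¹ * τ ^ (-(3 : ℝ) / 2) := by
        rw [integral_const_mul, ← Gamma_eq_integral (by norm_num)]
        ring
    _ ≤ _ := by gcongr
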